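/- Let n ≥ 1 and let v : ℝⁿ×ℝ → ℝ be smooth and satisfy the heat equation ∂_t v − Δv = 0 on all of ℝⁿ×ℝ. Assume: (i) ⨍_{Q₁} v = 0, ⨍_{Q₁} ∇v = 0, ⨍_{Q₁} D²v = 0 (entrywise), and ⨍_{Q₁} ∂_t v = 0; (ii) ∫_{Q_R} (|D²v|² + |∂_t v|²) ≤ R^{n+2}(1+R^{n+2}) for every R > 1; (iii) ⨍_{Q_R} ( |D²v − (D²v)̄_{Q_R}|² + |∂_t v − (∂_t v)̄_{Q_R}|² ) ≤ 1 for every R > 1. Then v ≡ 0 on ℝⁿ×ℝ. -/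

import Mathlib

open MeasureTheory Metric ENNReal

/-- The parabolic cube `Q_r(x₀,t₀) = B_r(x₀) × (t₀ − r²/2, t₀ + r²/2]` in `ℝⁿ × ℝ`. -/
noncomputable def pCube {n : ℕ} (r : ℝ) (c : EuclideanSpace ℝ (Fin n) × ℝ) :
    Set (EuclideanSpace ℝ (Fin n) × ℝ) :=
  (ball c.1 r) ×ˢ Set.Ioc (c.2 - r ^ 2 / 2) (c.2 + r ^ 2 / 2)

/-- Spatial partial derivative `∂_{x_i} u` of `u : ℝⁿ × ℝ → ℝ`. -/
noncomputable def pdx {n : ℕ} (i : Fin n) (u : EuclideanSpace ℝ (Fin n) × ℝ → ℝ) :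
    EuclideanSpace ℝ (Fin n) × ℝ → ℝ :=
  fun z => fderiv ℝ u z (EuclideanSpace.single i 1, 0)

/-- Time derivative `∂_t u` of `u : ℝⁿ × ℝ → ℝ`. -/
noncomputable def pdt {n : ℕ} (u : EuclideanSpace ℝ (Fin n) × ℝ → ℝ) :
    EuclideanSpace ℝ (Fin n) × ℝ → ℝ :=
  fun z => fderiv ℝ u z (0, 1)

/-- Entry `(i,j)` of the spatial Hessian `D²u`, i.e. `∂_{x_j} ∂_{x_i} u`. -/
noncomputable def hessEntryP {n : ℕ} (u : EuclideanSpace ℝ (Fin n) × ℝ → ℝ)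
    (i j : Fin n) : EuclideanSpace ℝ (Fin n) × ℝ → ℝ :=
  pdx j (pdx i u)

/-- Squared Frobenius norm `|D²u(z)|²` of the spatial Hessian. -/
noncomputable def hessFrobSqP {n : ℕ} (u : EuclideanSpace ℝ (Fin n) × ℝ → ℝ)
    (z : EuclideanSpace ℝ (Fin n) × ℝ) : ℝ :=
  ∑ i, ∑ j, (hessEntryP u i j z) ^ 2

/-- Spatial Laplacian `Δu = tr D²u`. -/
noncomputable def lapP {n : ℕ} (u : EuclideanSpace ℝ (Fin n) × ℝ → ℝ)
    (z : EuclideanSpace ℝ (Fin n) × ℝ) : ℝ :=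
  ∑ i, hessEntryP u i i z


section Helpers

variable {n : ℕ}

/-- Smooth entire solutions of the heat equation. -/
structure IsCaloric (u : EuclideanSpace ℝ (Fin n) × ℝ → ℝ) : Prop where
  smooth : ContDiff ℝ (⊤ : ℕ∞) u
  heat : ∀ z, pdt u z = lapP u z

theorem contDiff_fderiv_apply_const {E : Type*} [NormedAddCommGroup E] [NormedSpace ℝ E]
    {u : E → ℝ} (hu : ContDiff ℝ (⊤ : ℕ∞) u) (a : E) :
    ContDiff ℝ (⊤ : ℕ∞) (fun z => fderiv ℝ u z a) :=
  (hu.fderiv_right (m := (⊤ : ℕ∞)) (by simp)).clm_apply contDiff_const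

theorem fderiv_fderiv_apply_comm {E : Type*} [NormedAddCommGroup E] [NormedSpace ℝ E]
    {u : E → ℝ} (hu : ContDiff ℝ (⊤ : ℕ∞) u) (a b z : E) :
    fderiv ℝ (fun y => fderiv ℝ u y a) z b = fderiv ℝ (fun y => fderiv ℝ u y b) z a := by
  have hd : DifferentiableAt ℝ (fderiv ℝ u) z :=
    ((hu.fderiv_right (m := (⊤ : ℕ∞)) (by simp)).differentiable (by simp)) z
  have hs : IsSymmSndFDerivAt ℝ u z :=
    hu.contDiffAt.isSymmSndFDerivAt (by
      simp only [minSmoothness_of_isRCLikeNormedField]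
      exact WithTop.coe_le_coe.2 le_top)
  rw [fderiv_clm_apply hd (by fun_prop), fderiv_clm_apply hd (by fun_prop)]
  simpa using hs b a

theorem contDiff_pdx {u : EuclideanSpace ℝ (Fin n) × ℝ → ℝ} (hu : ContDiff ℝ (⊤ : ℕ∞) u)
    (i : Fin n) : ContDiff ℝ (⊤ : ℕ∞) (pdx i u) :=
  contDiff_fderiv_apply_const hu _

theorem contDiff_pdt {u : EuclideanSpace ℝ (Fin n) × ℝ → ℝ} (hu : ContDiff ℝ (⊤ : ℕ∞) u) :
    ContDiff ℝ (⊤ : ℕ∞) (pdt u) :=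
  contDiff_fderiv_apply_const hu _

theorem pdx_pdx_comm {u : EuclideanSpace ℝ (Fin n) × ℝ → ℝ} (hu : ContDiff ℝ (⊤ : ℕ∞) u)
    (i j : Fin n) : pdx i (pdx j u) = pdx j (pdx i u) :=
  funext fun z => fderiv_fderiv_apply_comm hu _ _ z

theorem pdt_pdx_comm {u : EuclideanSpace ℝ (Fin n) × ℝ → ℝ} (hu : ContDiff ℝ (⊤ : ℕ∞) u)
    (i : Fin n) : pdt (pdx i u) = pdx i (pdt u) :=
  funext fun z => fderiv_fderiv_apply_comm hu _ _ z

namespace IsCaloric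

variable {u : EuclideanSpace ℝ (Fin n) × ℝ → ℝ}

theorem spatialDeriv (hu : IsCaloric u) (i : Fin n) : IsCaloric (pdx i u) where
  smooth := contDiff_pdx hu.smooth i
  heat z := by
    have hheat : pdt u = fun z => ∑ j, pdx j (pdx j u) z := funext hu.heat
    rw [pdt_pdx_comm hu.smooth, hheat]
    unfold lapP hessEntryP
    have hdiff (j : Fin n) : DifferentiableAt ℝ (pdx j (pdx j u)) z :=
      (contDiff_pdx (contDiff_pdx hu.smooth j) j).differentiable (by simp) z
    have hsum : pdx i (fun z => ∑ j, pdx j (pdx j u) z) z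
        = ∑ j, pdx i (pdx j (pdx j u)) z := by
      change fderiv ℝ (fun z => ∑ j, pdx j (pdx j u) z) z _ = _
      rw [fderiv_fun_sum fun j _ => hdiff j]
      simp [pdx]
    rw [hsum]
    refine Finset.sum_congr rfl fun j _ => ?_
    rw [pdx_pdx_comm (contDiff_pdx hu.smooth j) i j, pdx_pdx_comm hu.smooth i j]

theorem pdx_sub_const (i : Fin n) (c : ℝ) : pdx i (fun z => u z - c) = pdx i u := by
  ext z
  simp [pdx, fderiv_sub_const]

theorem sub_const (hu : IsCaloric u) (c : ℝ) : IsCaloric (fun z => u z - c) where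
  smooth := hu.smooth.sub contDiff_const
  heat z := by
    simpa [pdt, lapP, hessEntryP, pdx_sub_const, fderiv_sub_const] using hu.heat z

/-- A caloric function with vanishing spatial gradient is constant. -/
theorem eq_const (hu : IsCaloric u) (hgrad : ∀ i z, pdx i u z = 0) (z) : u z = u 0 := by
  have ht (z) : pdt u z = 0 := by
    rw [hu.heat, lapP]
    refine Finset.sum_eq_zero fun i _ => ?_
    have h0 : pdx i u = fun _ => 0 := funext (hgrad i)
    simp [hessEntryP, h0, pdx]
  refine is_const_of_fderiv_eq_zero (𝕜 := ℝ) (hu.smooth.differentiable (by simp)) (fun y => ?_) z 0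
  refine ContinuousLinearMap.prod_ext ?_ ?_
  · apply ContinuousLinearMap.coe_injective
    refine (EuclideanSpace.basisFun (Fin n) ℝ).toBasis.ext fun i => ?_
    simpa [pdx] using hgrad i y
  · ext
    simpa [pdt] using ht y

end IsCaloric

theorem measurableSet_pCube (r : ℝ) (c : EuclideanSpace ℝ (Fin n) × ℝ) :
    MeasurableSet (pCube r c) :=
  measurableSet_ball.prod measurableSet_Ioc

theorem pCube_mono {r s : ℝ} (hr : 0 ≤ r) (hrs : r ≤ s) :
    pCube r (0 : EuclideanSpace ℝ (Fin n) × ℝ) ⊆ pCube s 0 := by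
  have : r ^ 2 ≤ s ^ 2 := by gcongr
  exact Set.prod_mono (ball_subset_ball hrs)
    (Set.Ioc_subset_Ioc (by linarith) (by linarith))

theorem measureReal_pCube {r : ℝ} (hr : 0 < r) :
    volume.real (pCube r (0 : EuclideanSpace ℝ (Fin n) × ℝ))
      = r ^ (n + 2) * volume.real (ball (0 : EuclideanSpace ℝ (Fin n)) 1) := by
  have hb : volume.real (ball (0 : EuclideanSpace ℝ (Fin n)) r)
      = r ^ n * volume.real (ball (0 : EuclideanSpace ℝ (Fin n)) 1) := by
    simp [Measure.real, Measure.addHaar_ball_of_pos volume (0 : EuclideanSpace ℝ (Fin n)) hr,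
      ENNReal.toReal_mul, ENNReal.toReal_ofReal (pow_nonneg hr.le n)]
  rw [pCube, Measure.volume_eq_prod, measureReal_prod_prod, Prod.fst_zero, Prod.snd_zero, hb,
    Real.volume_real_Ioc_of_le (by nlinarith)]
  ring

theorem measureReal_unitBall_pos : 0 < volume.real (ball (0 : EuclideanSpace ℝ (Fin n)) 1) :=
  ENNReal.toReal_pos (measure_ball_pos _ _ one_pos).ne' measure_ball_lt_top.ne

theorem Continuous.integrableOn_pCube {f : EuclideanSpace ℝ (Fin n) × ℝ → ℝ} (hf : Continuous f)
    (r : ℝ) (c : EuclideanSpace ℝ (Fin n) × ℝ) : IntegrableOn f (pCube r c) :=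
  (hf.continuousOn.integrableOn_compact
    ((isCompact_closedBall c.1 r).prod isCompact_Icc)).mono_set
    (Set.prod_mono ball_subset_closedBall Set.Ioc_subset_Icc_self)

theorem volume_pCube_ne_top (r : ℝ) (c : EuclideanSpace ℝ (Fin n) × ℝ) :
    volume (pCube r c) ≠ ∞ := by
  have := (continuous_const (y := (1 : ℝ))).integrableOn_pCube r c
  exact ((integrableOn_const_iff (by simp)).1 this).resolve_left (by simp) |>.ne

theorem IsCaloric.eq_zero_of_average_eq_zero {u : EuclideanSpace ℝ (Fin n) × ℝ → ℝ}
    (hu : IsCaloric u) (hgrad : ∀ i z, pdx i u z = 0)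
    (havg : (⨍ z in pCube 1 ((0 : EuclideanSpace ℝ (Fin n)), (0 : ℝ)), u z) = 0) (z) :
    u z = 0 := by
  have hpos : 0 < volume.real (pCube 1 (0 : EuclideanSpace ℝ (Fin n) × ℝ)) := by
    rw [measureReal_pCube one_pos]
    simpa using measureReal_unitBall_pos
  simp only [hu.eq_const hgrad] at havg ⊢
  rwa [setAverage_const (fun h => hpos.ne' (by
    rw [Measure.real]; exact (congrArg ENNReal.toReal h).trans (by simp)))
    (volume_pCube_ne_top _ _)] at havg

theorem eq_zero_of_forall_setIntegral_sq_eq_zero {u : EuclideanSpace ℝ (Fin n) × ℝ → ℝ}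
    (hu : Continuous u) (h : ∀ r : ℝ, 1 < r → ∫ z in pCube r 0, u z ^ 2 = 0) (z) : u z = 0 := by
  have hunion : ⋃ k : ℕ, pCube ((k : ℝ) + 2) (0 : EuclideanSpace ℝ (Fin n) × ℝ) = Set.univ := by
    refine Set.eq_univ_of_forall fun z => Set.mem_iUnion.2 ?_
    obtain ⟨k, hk⟩ := exists_nat_gt (‖z.1‖ + |z.2|)
    have := norm_nonneg z.1
    have := abs_nonneg z.2
    have := neg_abs_le z.2
    have := le_abs_self z.2
    refine ⟨k, ?_, ?_, ?_⟩
    · simp; linarith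
    · simp; nlinarith
    · simp; nlinarith
  have hae : ∀ᵐ z ∂(volume : Measure (EuclideanSpace ℝ (Fin n) × ℝ)), u z ^ 2 = 0 := by
    rw [← Measure.restrict_univ (μ := volume), ← hunion, ae_restrict_iUnion_iff]
    intro k
    exact (setIntegral_eq_zero_iff_of_nonneg_ae (.of_forall fun z => sq_nonneg _)
      ((hu.pow 2).integrableOn_pCube _ _)).1 (h _ (by linarith [k.cast_nonneg (α := ℝ)]))
  have : (fun z => u z ^ 2) = fun _ => 0 :=
    (Continuous.ae_eq_iff_eq volume (hu.pow 2) continuous_const).1 hae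
  simpa using congrFun this z

theorem integral_fderiv_apply_eq_zero {E : Type*} [NormedAddCommGroup E] [NormedSpace ℝ E]
    [FiniteDimensional ℝ E] [MeasurableSpace E] [BorelSpace E] (μ : Measure E)
    [μ.IsAddHaarMeasure] {h : E → ℝ} (hh : ContDiff ℝ (⊤ : ℕ∞) h) (hc : HasCompactSupport h)
    (a : E) : ∫ z, fderiv ℝ h z a ∂μ = 0 := by
  have hi : Integrable (fun z => fderiv ℝ h z a) μ :=
    (contDiff_fderiv_apply_const hh a).continuous.integrable_of_hasCompactSupport
      (hc.fderiv_apply (𝕜 := ℝ) a)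
  have := integral_mul_fderiv_eq_neg_fderiv_mul_of_integrable (μ := μ) (f := fun _ : E => (1 : ℝ))
    (g := h) (v := a) (by simp) (by simpa using hi)
    (by simpa using hh.continuous.integrable_of_hasCompactSupport hc)
    (fun _ _ => by fun_prop) (fun z _ => hh.differentiable (by simp) z)
  simpa using this

/-- A standard cutoff between the cubes of radius `1` and `2`. -/
theorem exists_cutoff (n : ℕ) : ∃ η : EuclideanSpace ℝ (Fin n) × ℝ → ℝ,
    ContDiff ℝ (⊤ : ℕ∞) η ∧ HasCompactSupport η ∧ (∀ z ∈ pCube 1 0, η z = 1) ∧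
      tsupport η ⊆ pCube 2 0 := by
  let χ : ContDiffBump (0 : EuclideanSpace ℝ (Fin n)) := ⟨1, 3 / 2, by norm_num, by norm_num⟩
  let τ : ContDiffBump (0 : ℝ) := ⟨1, 3 / 2, by norm_num, by norm_num⟩
  have hts : tsupport (fun z : EuclideanSpace ℝ (Fin n) × ℝ => χ z.1 * τ z.2)
      ⊆ closedBall 0 (3 / 2) ×ˢ closedBall 0 (3 / 2) := by
    refine closure_minimal (fun z hz => ?_) (isClosed_closedBall.prod isClosed_closedBall)
    have h1 : z.1 ∈ Function.support χ := left_ne_zero_of_mul hz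
    have h2 : z.2 ∈ Function.support τ := right_ne_zero_of_mul hz
    rw [ContDiffBump.support_eq] at h1 h2
    exact ⟨ball_subset_closedBall h1, ball_subset_closedBall h2⟩
  refine ⟨fun z => χ z.1 * τ z.2, ?_, ?_, ?_, hts.trans ?_⟩
  · exact (χ.contDiff.comp contDiff_fst).mul (τ.contDiff.comp contDiff_snd)
  · exact ((isCompact_closedBall _ _).prod (isCompact_closedBall _ _)).of_isClosed_subset
      (isClosed_tsupport _) hts
  · rintro z ⟨h1, h2⟩
    have h1' : z.1 ∈ closedBall (0 : EuclideanSpace ℝ (Fin n)) χ.rIn :=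
      ball_subset_closedBall h1
    have h2' : z.2 ∈ closedBall (0 : ℝ) τ.rIn := by
      simp only [Prod.snd_zero, Set.mem_Ioc] at h2
      simp only [mem_closedBall, dist_zero_right, Real.norm_eq_abs, τ, abs_le]
      constructor <;> linarith
    simp [χ.one_of_mem_closedBall h1', τ.one_of_mem_closedBall h2']
  · refine Set.prod_mono (closedBall_subset_ball (by norm_num)) fun t ht => ?_
    simp only [mem_closedBall, dist_zero_right, Real.norm_eq_abs, abs_le] at ht
    constructor <;> simp <;> linarith

theorem HasCompactSupport.exists_abs_le {E : Type*} [TopologicalSpace E] {f : E → ℝ}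
    (hc : HasCompactSupport f) (hf : Continuous f) : ∃ K, 0 ≤ K ∧ ∀ z, |f z| ≤ K := by
  obtain ⟨K, hK⟩ := hf.bounded_above_of_compact_support hc
  exact ⟨max K 0, le_max_right _ _, fun z => (hK z).trans (le_max_left _ _)⟩

/-- The energy identity integrated against a cutoff `η`. -/
theorem IsCaloric.integral_energy_le {u η : EuclideanSpace ℝ (Fin n) × ℝ → ℝ} (hu : IsCaloric u)
    (hη : ContDiff ℝ (⊤ : ℕ∞) η) (hc : HasCompactSupport η) :
    ∫ z, η z ^ 2 * ∑ i, pdx i u z ^ 2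
      ≤ ∫ z, (4 * ∑ i, pdx i η z ^ 2 + 2 * (η z * pdt η z)) * u z ^ 2 := by
  have hus := hu.smooth
  have : (volume : Measure (EuclideanSpace ℝ (Fin n) × ℝ)).IsAddHaarMeasure :=
    Measure.prod.instIsAddHaarMeasure volume volume
  have hux (i) := contDiff_pdx hus i
  have hηx (i) := contDiff_pdx hη i
  have hηt := contDiff_pdt hη
  have hηd : Differentiable ℝ η := hη.differentiable (by simp)
  have hud : Differentiable ℝ u := hus.differentiable (by simp)
  have huxd (i) : Differentiable ℝ (pdx i u) := (hux i).differentiable (by simp)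
  have hcx (i) : HasCompactSupport (pdx i η) := hc.fderiv_apply (𝕜 := ℝ) _
  let F (i : Fin n) (z : EuclideanSpace ℝ (Fin n) × ℝ) : ℝ := η z * (η z * (u z * pdx i u z))
  let G (z : EuclideanSpace ℝ (Fin n) × ℝ) : ℝ := η z * (η z * (u z * u z))
  have hF (i) : ContDiff ℝ (⊤ : ℕ∞) (F i) := hη.mul (hη.mul (hus.mul (hux i)))
  have hG : ContDiff ℝ (⊤ : ℕ∞) G := hη.mul (hη.mul (hus.mul hus))
  have hFc (i) : HasCompactSupport (F i) := hc.mul_right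
  have hGc : HasCompactSupport G := hc.mul_right
  have hFi (i) : ∫ z, pdx i (F i) z = 0 := integral_fderiv_apply_eq_zero volume (hF i) (hFc i) _
  have hGi : ∫ z, pdt G z = 0 := integral_fderiv_apply_eq_zero volume hG hGc _
  have hFint (i) : Integrable (pdx i (F i)) :=
    (contDiff_pdx (hF i) i).continuous.integrable_of_hasCompactSupport
      ((hFc i).fderiv_apply (𝕜 := ℝ) _)
  have hGint : Integrable (pdt G) :=
    (contDiff_pdt hG).continuous.integrable_of_hasCompactSupport (hGc.fderiv_apply (𝕜 := ℝ) _)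
  have hFx (i z) : pdx i (F i) z = 2 * η z * pdx i η z * u z * pdx i u z
      + η z ^ 2 * pdx i u z ^ 2 + η z ^ 2 * u z * hessEntryP u i i z := by
    have h1 := (hηd z).hasFDerivAt
    have := (h1.mul (h1.mul ((hud z).hasFDerivAt.mul (huxd i z).hasFDerivAt))).fderiv
    change fderiv ℝ (η * (η * (u * pdx i u))) z _ = _
    rw [this]
    simp only [hessEntryP, pdx, add_apply, smul_apply,
      smul_eq_mul, Pi.mul_apply]
    ring
  have hGt (z) : pdt G z = 2 * (η z * pdt η z) * u z ^ 2 + 2 * η z ^ 2 * u z * lapP u z := by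
    have h1 := (hηd z).hasFDerivAt
    have := (h1.mul (h1.mul ((hud z).hasFDerivAt.mul (hud z).hasFDerivAt))).fderiv
    rw [← hu.heat]
    change fderiv ℝ (η * (η * (u * u))) z _ = _
    rw [this]
    simp only [pdt, add_apply, smul_apply,
      smul_eq_mul, Pi.mul_apply]
    ring
  have hpt (z) : η z ^ 2 * ∑ i, pdx i u z ^ 2
      ≤ (4 * ∑ i, pdx i η z ^ 2 + 2 * (η z * pdt η z)) * u z ^ 2
        + (2 * ∑ i, pdx i (F i) z - pdt G z) := by
    have hsum : ∑ i, η z ^ 2 * pdx i u z ^ 2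
        ≤ ∑ i, (4 * pdx i η z ^ 2 * u z ^ 2 + 2 * (pdx i (F i) z
          - η z ^ 2 * u z * hessEntryP u i i z)) := by
      refine Finset.sum_le_sum fun i _ => ?_
      rw [hFx]
      nlinarith [sq_nonneg (η z * pdx i u z + 2 * (pdx i η z * u z))]
    rw [hGt, lapP]
    simp only [Finset.sum_add_distrib, ← Finset.mul_sum, ← Finset.sum_mul,
      Finset.sum_sub_distrib] at hsum
    linarith
  have hint : Integrable fun z =>
      (4 * ∑ i, pdx i η z ^ 2 + 2 * (η z * pdt η z)) * u z ^ 2 := by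
    refine Continuous.integrable_of_hasCompactSupport ?_ ?_
    · exact ((continuous_const.mul (continuous_finsetSum _ fun i _ => (hηx i).continuous.pow 2)).add
        (continuous_const.mul (hη.continuous.mul hηt.continuous))).mul (hus.continuous.pow 2)
    · refine hc.mono' fun z hz => ?_
      by_contra hzs
      have hd : fderiv ℝ η z = 0 := fderiv_of_notMem_tsupport ℝ hzs
      simp [pdx, pdt, hd] at hz
  have hdiv : Integrable fun z => 2 * ∑ i, pdx i (F i) z - pdt G z :=
    ((integrable_finsetSum _ fun i _ => hFint i).const_mul 2).sub hGint
  have hzero : ∫ z, (2 * ∑ i, pdx i (F i) z - pdt G z) = 0 := by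
    rw [integral_sub ((integrable_finsetSum _ fun i _ => hFint i).const_mul 2) hGint,
      integral_const_mul, integral_finsetSum _ fun i _ => hFint i]
    simp [hFi, hGi]
  calc ∫ z, η z ^ 2 * ∑ i, pdx i u z ^ 2
      ≤ ∫ z, ((4 * ∑ i, pdx i η z ^ 2 + 2 * (η z * pdt η z)) * u z ^ 2
        + (2 * ∑ i, pdx i (F i) z - pdt G z)) := by
        refine integral_mono ?_ (hint.add hdiv) hpt
        refine Continuous.integrable_of_hasCompactSupport ?_ ?_
        · exact (hη.continuous.pow 2).mul
            (continuous_finsetSum _ fun i _ => (hux i).continuous.pow 2)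
        · simp only [sq, mul_assoc]
          exact hc.mul_right
    _ = _ := by rw [integral_add hint hdiv, hzero, add_zero]

/-- Caccioppoli's inequality on parabolic cubes. -/
theorem exists_caccioppoli (n : ℕ) : ∃ K : ℝ, 0 ≤ K ∧
    ∀ u : EuclideanSpace ℝ (Fin n) × ℝ → ℝ, IsCaloric u → ∀ i, ∀ R : ℝ, 0 < R →
      R ^ 2 * ∫ z in pCube R 0, pdx i u z ^ 2 ≤ K * ∫ z in pCube (2 * R) 0, u z ^ 2 := by
  obtain ⟨η, hη, hc, hone, hsupp⟩ := exists_cutoff n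
  let κ (z : EuclideanSpace ℝ (Fin n) × ℝ) : ℝ := 4 * ∑ i, pdx i η z ^ 2 + 2 * (η z * pdt η z)
  have hκ0 {z} (hz : z ∉ tsupport η) : κ z = 0 := by
    have hd : fderiv ℝ η z = 0 := fderiv_of_notMem_tsupport ℝ hz
    simp [κ, pdx, pdt, hd]
  have hκc : Continuous κ :=
    (continuous_const.mul
      (continuous_finsetSum _ fun i _ => (contDiff_pdx hη i).continuous.pow 2)).add
      (continuous_const.mul (hη.continuous.mul (contDiff_pdt hη).continuous))
  obtain ⟨K, hK, hκK⟩ := (hc.mono' (f' := κ) fun z hz => by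
    by_contra h; exact hz (hκ0 h)).exists_abs_le hκc
  refine ⟨K, hK, fun u hu i R hR => ?_⟩
  let L : EuclideanSpace ℝ (Fin n) × ℝ →L[ℝ] EuclideanSpace ℝ (Fin n) × ℝ :=
    (R⁻¹ • ContinuousLinearMap.fst ℝ _ _).prod ((R⁻¹ ^ 2) • ContinuousLinearMap.snd ℝ _ _)
  have hLz (z) : L z = (R⁻¹ • z.1, R⁻¹ ^ 2 * z.2) := rfl
  have hLmem (r : ℝ) (z) : L z ∈ pCube r 0 ↔ z ∈ pCube (r * R) 0 := by
    simp only [hLz, pCube, Set.mem_prod, mem_ball, dist_zero_right, Prod.fst_zero, Prod.snd_zero,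
      norm_smul, norm_inv, Real.norm_of_nonneg hR.le, Set.mem_Ioc, inv_pow,
      inv_mul_lt_iff₀ hR, lt_inv_mul_iff₀ (pow_pos hR 2), inv_mul_le_iff₀ (pow_pos hR 2)]
    ring_nf
  let ηR := η ∘ L
  have hηR : ContDiff ℝ (⊤ : ℕ∞) ηR := hη.comp L.contDiff
  have hLd (z w) : fderiv ℝ ηR z w = fderiv ℝ η (L z) (L w) := by
    have := (((hη.differentiable (by simp)) (L z)).hasFDerivAt.comp z L.hasFDerivAt).fderiv
    simp [ηR, this]
  have hLx (j z) : pdx j ηR z = R⁻¹ * pdx j η (L z) := by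
    have : L (EuclideanSpace.single j 1, 0) = R⁻¹ • (EuclideanSpace.single j 1, 0) := by
      simp [hLz]
    simp only [pdx, hLd]
    rw [this, map_smul, smul_eq_mul]
  have hLt (z) : pdt ηR z = R⁻¹ ^ 2 * pdt η (L z) := by
    have : L (0, 1) = R⁻¹ ^ 2 • (0, 1) := by simp [hLz]
    simp only [pdt, hLd]
    rw [this, map_smul, smul_eq_mul]
  have hcR : HasCompactSupport ηR := by
    refine HasCompactSupport.intro
      (K := closedBall 0 (2 * R) ×ˢ Set.Icc (-(2 * R) ^ 2 / 2) ((2 * R) ^ 2 / 2))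
      ((isCompact_closedBall _ _).prod isCompact_Icc) fun z hz => ?_
    by_contra h
    have hmem := (hLmem 2 z).1 (hsupp (subset_tsupport _ h))
    refine hz ⟨ball_subset_closedBall hmem.1, ?_, ?_⟩
    · have := hmem.2.1
      simp only [Prod.snd_zero] at this
      linarith
    · have := hmem.2.2
      simp only [Prod.snd_zero] at this
      linarith
  have henergy := hu.integral_energy_le hηR hcR
  have hκR (z) : 4 * ∑ i, pdx i ηR z ^ 2 + 2 * (ηR z * pdt ηR z) = R⁻¹ ^ 2 * κ (L z) := by
    simp only [hLx, hLt, κ, mul_pow, ← Finset.mul_sum, ηR, Function.comp_apply]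
    ring
  have hux (i) := (contDiff_pdx hu.smooth i).continuous
  have hleft : ∫ z in pCube R 0, pdx i u z ^ 2 ≤ ∫ z, ηR z ^ 2 * ∑ i, pdx i u z ^ 2 := by
    rw [← integral_indicator (measurableSet_pCube _ _)]
    refine integral_mono
      (((hux i).pow 2).integrableOn_pCube _ _ |>.integrable_indicator (measurableSet_pCube _ _))
      (Continuous.integrable_of_hasCompactSupport ?_ ?_) fun z => ?_
    · exact (hηR.continuous.pow 2).mul (continuous_finsetSum _ fun i _ => (hux i).pow 2)
    · simp only [sq, mul_assoc]
      exact hcR.mul_right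
    · by_cases hz : z ∈ pCube R 0
      · have h1 : ηR z = 1 := hone _ ((hLmem 1 z).2 (by rwa [one_mul]))
        rw [Set.indicator_of_mem hz, h1, one_pow, one_mul]
        exact Finset.single_le_sum (f := fun i => pdx i u z ^ 2) (fun _ _ => sq_nonneg _)
          (Finset.mem_univ i)
      · rw [Set.indicator_of_notMem hz]
        positivity
  have hright : ∫ z, R⁻¹ ^ 2 * κ (L z) * u z ^ 2
      ≤ R⁻¹ ^ 2 * (K * ∫ z in pCube (2 * R) 0, u z ^ 2) := by
    simp only [mul_assoc]
    rw [integral_const_mul, ← integral_const_mul K]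
    refine mul_le_mul_of_nonneg_left ?_ (by positivity)
    have hzero (z) (hz : z ∉ pCube (2 * R) 0) : κ (L z) * u z ^ 2 = 0 := by
      rw [hκ0 fun h => hz ((hLmem 2 z).1 (hsupp h)), zero_mul]
    rw [← setIntegral_eq_integral_of_forall_compl_eq_zero hzero]
    refine setIntegral_mono
      (((hκc.comp L.continuous).mul (hu.smooth.continuous.pow 2)).integrableOn_pCube _ _)
      ((continuous_const.mul (hu.smooth.continuous.pow 2)).integrableOn_pCube _ _) fun z => ?_
    exact mul_le_mul_of_nonneg_right ((le_abs_self _).trans (hκK _)) (sq_nonneg _)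
  simp only [hκR] at henergy
  calc R ^ 2 * ∫ z in pCube R 0, pdx i u z ^ 2
      ≤ R ^ 2 * (R⁻¹ ^ 2 * (K * ∫ z in pCube (2 * R) 0, u z ^ 2)) :=
        mul_le_mul_of_nonneg_left (hleft.trans (henergy.trans hright)) (by positivity)
    _ = K * ∫ z in pCube (2 * R) 0, u z ^ 2 := by field_simp

/-- A caloric function whose square integral over `Q_R` is `O(R^{n+2-2k})` with `k ≥ 1`
vanishes. -/
theorem IsCaloric.eq_zero_of_decay (m : ℕ) : ∀ k : ℕ, 1 ≤ k → n + 2 < 2 * k + 2 * m →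
    ∀ {u : EuclideanSpace ℝ (Fin n) × ℝ → ℝ}, IsCaloric u → ∀ C : ℝ,
      (∀ R : ℝ, 1 < R → R ^ (2 * k) * ∫ z in pCube R 0, u z ^ 2 ≤ C * R ^ (n + 2)) →
      ∀ z, u z = 0 := by
  induction m with
  | zero =>
    intro k hk hm u hu C hC
    refine eq_zero_of_forall_setIntegral_sq_eq_zero hu.smooth.continuous fun r hr => ?_
    have hnn (s : ℝ) : 0 ≤ ∫ z in pCube s (0 : EuclideanSpace ℝ (Fin n) × ℝ), u z ^ 2 :=
      integral_nonneg fun _ => sq_nonneg _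
    by_contra hne
    have hpos := (hnn r).lt_of_ne' hne
    set I := ∫ z in pCube r (0 : EuclideanSpace ℝ (Fin n) × ℝ), u z ^ 2
    have hlin (R : ℝ) (hR : r < R) : R * I ≤ C := by
      have hR0 : 0 < R := by linarith
      have hmono : I ≤ ∫ z in pCube R (0 : EuclideanSpace ℝ (Fin n) × ℝ), u z ^ 2 :=
        setIntegral_mono_set ((hu.smooth.continuous.pow 2).integrableOn_pCube _ _)
          (.of_forall fun _ => sq_nonneg _) (pCube_mono (by linarith) hR.le).eventuallyLE
      have hpow : R ^ (n + 3) ≤ R ^ (2 * k) := pow_le_pow_right₀ (by linarith) (by lia)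
      have hle : R ^ (n + 2) * (R * I) ≤ R ^ (n + 2) * C := by
        calc R ^ (n + 2) * (R * I) = R ^ (n + 3) * I := by ring
          _ ≤ R ^ (2 * k) * ∫ z in pCube R (0 : EuclideanSpace ℝ (Fin n) × ℝ), u z ^ 2 := by gcongr
          _ ≤ R ^ (n + 2) * C := by linarith [hC R (by linarith)]
      exact le_of_mul_le_mul_left hle (by positivity)
    have h := hlin (r + |C| / I + 1) (by linarith [div_nonneg (abs_nonneg C) hpos.le])
    have : |C| / I * I = |C| := by field_simp
    nlinarith [le_abs_self C]
  | succ m ih =>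
    intro k hk hm u hu C hC
    obtain ⟨K, hK, hcacc⟩ := exists_caccioppoli n
    have hgrad (i z) : pdx i u z = 0 := by
      refine ih (k + 1) (by lia) (by lia) (hu.spatialDeriv i) (K * C * 2 ^ (n + 2))
        (fun R hR => ?_) z
      have hnn : 0 ≤ ∫ z in pCube (2 * R) (0 : EuclideanSpace ℝ (Fin n) × ℝ), u z ^ 2 :=
        integral_nonneg fun _ => sq_nonneg _
      calc R ^ (2 * (k + 1)) * ∫ z in pCube R 0, pdx i u z ^ 2
          = R ^ (2 * k) * (R ^ 2 * ∫ z in pCube R 0, pdx i u z ^ 2) := by ring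
        _ ≤ R ^ (2 * k) * (K * ∫ z in pCube (2 * R) 0, u z ^ 2) := by
          exact mul_le_mul_of_nonneg_left (hcacc u hu i R (by linarith)) (by positivity)
        _ = K * (R ^ (2 * k) * ∫ z in pCube (2 * R) 0, u z ^ 2) := by ring
        _ ≤ K * ((2 * R) ^ (2 * k) * ∫ z in pCube (2 * R) 0, u z ^ 2) := by
          gcongr
          linarith
        _ ≤ K * (C * (2 * R) ^ (n + 2)) := by
          exact mul_le_mul_of_nonneg_left (hC (2 * R) (by linarith)) hK
        _ = _ := by ring
    have hconst := hu.eq_const hgrad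
    set V := volume.real (ball (0 : EuclideanSpace ℝ (Fin n)) 1)
    have hV : 0 < V := measureReal_unitBall_pos
    have hbound (R : ℝ) (hR : 1 < R) : R * (V * u 0 ^ 2) ≤ C := by
      have h := hC R hR
      simp only [hconst] at h
      rw [setIntegral_const, measureReal_pCube (by linarith), smul_eq_mul] at h
      have hpow : R ≤ R ^ (2 * k) := le_self_pow₀ hR.le (by lia)
      have hle : R ^ (n + 2) * (R * (V * u 0 ^ 2)) ≤ R ^ (n + 2) * C := by
        calc R ^ (n + 2) * (R * (V * u 0 ^ 2)) ≤ R ^ (n + 2) * (R ^ (2 * k) * (V * u 0 ^ 2)) := by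
              gcongr
          _ = R ^ (2 * k) * (R ^ (n + 2) * V * u 0 ^ 2) := by ring
          _ ≤ R ^ (n + 2) * C := by linarith
      exact le_of_mul_le_mul_left hle (by positivity)
    intro z
    rw [hconst]
    by_contra hne
    have hA : 0 < V * u 0 ^ 2 := by positivity
    set A := V * u 0 ^ 2
    have h := hbound (|C| / A + 2) (by linarith [div_nonneg (abs_nonneg C) hA.le])
    have : |C| / A * A = |C| := by field_simp
    nlinarith [le_abs_self C]

/-- A caloric function with bounded mean square oscillation over all large centred cubes has
vanishing spatial gradient. -/
theorem IsCaloric.pdx_eq_zero_of_oscillation {u : EuclideanSpace ℝ (Fin n) × ℝ → ℝ}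
    (hu : IsCaloric u) (C : ℝ)
    (hosc : ∀ R : ℝ, 1 < R → ∃ c : ℝ, ∫ z in pCube R 0, (u z - c) ^ 2 ≤ C * R ^ (n + 2))
    (i) (z) : pdx i u z = 0 := by
  obtain ⟨K, hK, hcacc⟩ := exists_caccioppoli n
  refine (hu.spatialDeriv i).eq_zero_of_decay (n + 2) 1 le_rfl (by lia) (K * C * 2 ^ (n + 2))
    (fun R hR => ?_) z
  obtain ⟨c, hc⟩ := hosc (2 * R) (by linarith)
  have h := hcacc _ (hu.sub_const c) i R (by linarith)
  rw [IsCaloric.pdx_sub_const] at h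
  calc R ^ (2 * 1) * ∫ z in pCube R 0, pdx i u z ^ 2
      ≤ K * ∫ z in pCube (2 * R) 0, (u z - c) ^ 2 := by simpa using h
    _ ≤ K * (C * (2 * R) ^ (n + 2)) := by gcongr
    _ = _ := by ring

end Helpers

/-- Liouville-type rigidity for the parabolic blow-up limit: a smooth entire solution of
the heat equation with vanishing averages of `v`, `∇v`, `D²v`, `∂_t v` over `Q₁`, with
`∫_{Q_R}(|D²v|² + |∂_t v|²) ≤ R^{n+2}(1+R^{n+2})` and
`⨍_{Q_R}(|D²v − (D²v)̄_{Q_R}|² + |∂_t v − (∂_t v)̄_{Q_R}|²) ≤ 1` for all `R > 1`,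
must vanish identically. -/
theorem liouville_rigidity_parabolic (n : ℕ) (hn : 1 ≤ n)
    (v : EuclideanSpace ℝ (Fin n) × ℝ → ℝ) (hv : ContDiff ℝ (⊤ : ℕ∞) v)
    (hheat : ∀ z, pdt v z - lapP v z = 0)
    (havg : (⨍ z in pCube 1 ((0 : EuclideanSpace ℝ (Fin n)), (0 : ℝ)), v z) = 0)
    (hgrad : ∀ i, (⨍ z in pCube 1 ((0 : EuclideanSpace ℝ (Fin n)), (0 : ℝ)), pdx i v z) = 0)
    (hhess : ∀ i j,
      (⨍ z in pCube 1 ((0 : EuclideanSpace ℝ (Fin n)), (0 : ℝ)), hessEntryP v i j z) = 0)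
    (htime : (⨍ z in pCube 1 ((0 : EuclideanSpace ℝ (Fin n)), (0 : ℝ)), pdt v z) = 0)
    (hgrowth : ∀ R : ℝ, 1 < R →
      (∫ z in pCube R ((0 : EuclideanSpace ℝ (Fin n)), (0 : ℝ)),
          (hessFrobSqP v z + (pdt v z) ^ 2)) ≤ R ^ (n + 2) * (1 + R ^ (n + 2)))
    (hosc : ∀ R : ℝ, 1 < R →
      (⨍ z in pCube R ((0 : EuclideanSpace ℝ (Fin n)), (0 : ℝ)),
        ((∑ i, ∑ j,
            (hessEntryP v i j z -
              ⨍ z' in pCube R ((0 : EuclideanSpace ℝ (Fin n)), (0 : ℝ)),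
                hessEntryP v i j z') ^ 2) +
          (pdt v z -
            ⨍ z' in pCube R ((0 : EuclideanSpace ℝ (Fin n)), (0 : ℝ)), pdt v z') ^ 2)) ≤ 1) :
    ∀ z, v z = 0 := by
  have hcal : IsCaloric v := ⟨hv, fun z => sub_eq_zero.1 (hheat z)⟩
  have hhess_zero (i j z) : pdx j (pdx i v) z = 0 := by
    have hij : IsCaloric (hessEntryP v i j) := (hcal.spatialDeriv i).spatialDeriv j
    refine hij.eq_zero_of_average_eq_zero (hij.pdx_eq_zero_of_oscillation
      (volume.real (ball (0 : EuclideanSpace ℝ (Fin n)) 1)) fun R hR => ⟨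
        ⨍ z' in pCube R ((0 : EuclideanSpace ℝ (Fin n)), (0 : ℝ)), hessEntryP v i j z', ?_⟩)
      (hhess i j) z
    have hc (i j) : Continuous (hessEntryP v i j) :=
      ((hcal.spatialDeriv i).spatialDeriv j).smooth.continuous
    have hct : Continuous (pdt v) := (contDiff_pdt hv).continuous
    have hR0 : 0 < R := by linarith
    have hpos : 0 < volume.real (pCube R (0 : EuclideanSpace ℝ (Fin n) × ℝ)) := by
      rw [measureReal_pCube hR0]
      have := measureReal_unitBall_pos (n := n)
      positivity
    have h := hosc R hR
    simp only [Prod.mk_zero_zero] at h ⊢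
    rw [setAverage_eq, smul_eq_mul, inv_mul_le_iff₀ hpos, mul_one] at h
    rw [mul_comm, ← measureReal_pCube hR0]
    refine le_trans (setIntegral_mono (Continuous.integrableOn_pCube (by fun_prop) _ _)
      (Continuous.integrableOn_pCube (by fun_prop) _ _) fun z => ?_) h
    refine le_trans ?_ (le_add_of_nonneg_right (sq_nonneg _))
    refine le_trans ?_ (Finset.single_le_sum (fun _ _ => Finset.sum_nonneg fun _ _ => sq_nonneg _)
      (Finset.mem_univ i))
    exact Finset.single_le_sum
      (f := fun j => (hessEntryP v i j z - ⨍ z' in pCube R 0, hessEntryP v i j z') ^ 2)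
      (fun _ _ => sq_nonneg _) (Finset.mem_univ j)
  have hgrad_zero (i z) : pdx i v z = 0 :=
    (hcal.spatialDeriv i).eq_zero_of_average_eq_zero (hhess_zero i) (hgrad i) z
  exact hcal.eq_zero_of_average_eq_zero hgrad_zero havg
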